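/- Suppose M = m − 2n does not belong to {0, −2, −4, −6, …}. If p ∈ ℂ[x_1,…,x_m]⊗Λ_{2n} is homogeneous of total degree k and satisfies p(∂_x) exp(x²/2) = p(x) exp(x²/2), then Δp = 0, i.e. p is a super spherical harmonic of degree k. Here p(∂_x) is the differential operator obtained from p by substituting x_i → −∂_{x_i}, x`_{2i} → 2∂_{x`_{2i−1}}, x`_{2i−1} → −2∂_{x`_{2i}}, and exp(x²/2) = exp(−(x_1²+⋯+x_m²)/2)·Σ_{j=0}^n (x`²)^j/(2^j j!) with x`² = Σ_{j=1}^n x`_{2j−1} x`_{2j}. -/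

import Mathlib

open scoped BigOperators
open Finset MeasureTheory

noncomputable section

/-- The Grassmann algebra on `N` anticommuting generators with coefficients in a
commutative ring `R`, represented by its coefficients with respect to the basis of
increasingly-ordered monomials, indexed by subsets of the generators. -/
abbrev Gr (R : Type) (N : ℕ) : Type := Finset (Fin N) → R

namespace Gr

variable {R : Type} [CommRing R] {N : ℕ}

/-- The sign produced when reordering the concatenation of the ordered monomials indexed
by `A` and `B` into the ordered monomial indexed by `A ∪ B`. -/
def msign (A B : Finset (Fin N)) : R :=
  (-1 : R) ^ (((A ×ˢ B).filter fun p => p.2 < p.1).card)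

/-- Multiplication of the Grassmann algebra. -/
def mul (f g : Gr R N) : Gr R N :=
  fun s => ∑ A ∈ s.powerset, msign A (s \ A) * f A * g (s \ A)

/-- The unit of the Grassmann algebra. -/
def one : Gr R N := fun s => if s = (∅ : Finset (Fin N)) then 1 else 0

/-- The `j`-th generator of the Grassmann algebra. -/
def gen (j : Fin N) : Gr R N := fun s => if s = {j} then 1 else 0

/-- Powers in the Grassmann algebra. -/
def pow (f : Gr R N) : ℕ → Gr R N
  | 0 => one
  | k + 1 => mul (pow f k) f

/-- The left partial derivative `∂_j`, i.e. the odd derivation with `∂_j(x_k) = δ_{jk}`. -/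
def pderiv (j : Fin N) (f : Gr R N) : Gr R N :=
  fun s => if j ∈ s then 0
    else (-1 : R) ^ ((s.filter fun i => i < j).card) * f (insert j s)

/-- The exponential of a Grassmann algebra element with nilpotent (zero-constant-term)
argument: the series terminates, and all terms beyond degree `N` vanish. -/
def gexp (f : Gr ℂ N) : Gr ℂ N :=
  ∑ k ∈ Finset.range (N + 1), ((k.factorial : ℂ))⁻¹ • pow f k

/-- Iterated left partial derivatives: the first element of the list acts first. -/
def derivList (l : List (Fin N)) (f : Gr R N) : Gr R N :=
  l.foldl (fun g j => pderiv j g) f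

/-- Complex conjugation of the coefficients. -/
def gconj (f : Gr ℂ N) : Gr ℂ N := fun s => (starRingEnd ℂ) (f s)

end Gr

/-- The Lean index of the paper's generator `x`_{2j-1}` (j = 1,…,n). -/
def lo (n : ℕ) (j : Fin n) : Fin (2 * n) := ⟨2 * (j : ℕ), by have := j.isLt; omega⟩

/-- The Lean index of the paper's generator `x`_{2j}` (j = 1,…,n). -/
def hi (n : ℕ) (j : Fin n) : Fin (2 * n) := ⟨2 * (j : ℕ) + 1, by have := j.isLt; omega⟩

/-- `x`² = Σ_{j=1}^n x`_{2j-1} x`_{2j}`. -/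
def xsq (n : ℕ) : Gr ℂ (2 * n) := ∑ j : Fin n, Gr.mul (Gr.gen (lo n j)) (Gr.gen (hi n j))

/-- The fermionic Laplace operator `Δ_f = 4 Σ_{j=1}^n ∂_{x`_{2j-1}} ∂_{x`_{2j}}`. -/
def lapF (n : ℕ) (f : Gr ℂ (2 * n)) : Gr ℂ (2 * n) :=
  (4 : ℂ) • ∑ j : Fin n, Gr.pderiv (lo n j) (Gr.pderiv (hi n j) f)

/-- The Berezin integral `∫_B = π^{-n} ∂_{x`_{2n}} ⋯ ∂_{x`_1}`. -/
def berezin (n : ℕ) (f : Gr ℂ (2 * n)) : ℂ :=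
  ((Real.pi : ℂ) ^ n)⁻¹ * Gr.derivList (List.finRange (2 * n)) f ∅

/-- The fermionic Gaussian `exp(x`²/2) = Σ_{j=0}^n (x`²)^j/(2^j j!)`. -/
def fermGauss (n : ℕ) : Gr ℂ (2 * n) :=
  ∑ j ∈ Finset.range (n + 1), (((2 : ℂ) ^ j * j.factorial)⁻¹) • Gr.pow (xsq n) j

/-- Embedding of the `x` generators into the Grassmann algebra on the `4n` generators
`x`_1, …, x`_{2n}, y`_1, …, y`_{2n}` (the `x` generators come first). -/
def xi (n : ℕ) (t : Fin (2 * n)) : Fin (2 * n + 2 * n) := Fin.castAdd (2 * n) t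

/-- Embedding of the `y` generators into the Grassmann algebra on the `4n` generators. -/
def yi (n : ℕ) (t : Fin (2 * n)) : Fin (2 * n + 2 * n) := Fin.natAdd (2 * n) t

/-- The algebra embedding `Λ_{2n} → Λ_{4n}` sending the generators to the `x` generators. -/
def embX (n : ℕ) (f : Gr ℂ (2 * n)) : Gr ℂ (2 * n + 2 * n) :=
  fun s => ∑ A : Finset (Fin (2 * n)), if s = A.image (xi n) then f A else 0

/-- The Berezin integral with respect to the `x` variables,
`π^{-n} ∂_{x`_{2n}} ⋯ ∂_{x`_1}`, inside the mixed algebra `Λ_{4n}`. -/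
def berezinX (n : ℕ) (F : Gr ℂ (2 * n + 2 * n)) : Gr ℂ (2 * n + 2 * n) :=
  ((Real.pi : ℂ) ^ n)⁻¹ • Gr.derivList ((List.finRange (2 * n)).map (xi n)) F

/-- The fermionic Fourier kernel
`K^σ(x, y) = exp(-σ (i/2) Σ_{j=1}^n (x`_{2j-1} y`_{2j} - x`_{2j} y`_{2j-1}))`
(for the plus sign `σ = 1`, for the minus sign `σ = -1`). -/
def fermK (n : ℕ) (σ : ℂ) : Gr ℂ (2 * n + 2 * n) :=
  Gr.gexp ((-σ * (Complex.I / 2)) • ∑ j : Fin n,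
    (Gr.mul (Gr.gen (xi n (lo n j))) (Gr.gen (yi n (hi n j))) -
     Gr.mul (Gr.gen (xi n (hi n j))) (Gr.gen (yi n (lo n j)))))

/-- The fermionic Fourier transform
`F^σ_{0|2n}(g)(y) = (2π)^n ∫_{B,x} K^σ(x,y) g(x)`, an element of the Grassmann algebra
in the `y` variables, identified with `Λ_{2n}`. -/
def fermFT (n : ℕ) (σ : ℂ) (g : Gr ℂ (2 * n)) : Gr ℂ (2 * n) :=
  fun s => (((2 * Real.pi : ℝ) : ℂ) ^ n) *
    berezinX n (Gr.mul (fermK n σ) (embX n g)) (s.image (yi n))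


end
noncomputable section

/-- Functions on `ℝ^m` with values in the Grassmann algebra `Λ_{2n}`; the elements with
Schwartz coefficients form the space `S(ℝ^m)_{m|2n}`. -/
abbrev SF (m n : ℕ) : Type := ((Fin m) → ℝ) → Gr ℂ (2 * n)

/-- `f ∈ S(ℝ^m)_{m|2n}`: every Grassmann coefficient of `f` is a Schwartz function. -/
def IsSchwartz (m n : ℕ) (f : SF m n) : Prop :=
  ∀ s : Finset (Fin (2 * n)), ∃ φ : SchwartzMap ((Fin m) → ℝ) ℂ, ∀ x, f x s = φ x

/-- The super Fourier transform
`F^σ_{m|2n}(f)(y) = (2π)^{-M/2} ∫_{ℝ^m} dV(x) ∫_{B,x} exp(σ i Σ_i x_i y_i) K^σ(x,y) f(x)`,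
with `M = m - 2n` (plus sign: `σ = 1`; minus sign: `σ = -1`). -/
def superFT (m n : ℕ) (σ : ℂ) (f : SF m n) : SF m n :=
  fun y s => (((2 * Real.pi : ℝ) : ℂ) ^ ((-((m : ℂ) - 2 * (n : ℂ))) / 2)) *
    ∫ x : (Fin m) → ℝ, Complex.exp (σ * Complex.I * ∑ i, (x i : ℂ) * (y i : ℂ)) *
      berezinX n (Gr.mul (fermK n σ) (embX n (f x))) (s.image (yi n))

/-- The partial derivative `∂_{x_i}` of a `Λ_{2n}`-valued function, acting coefficientwise. -/
def bderiv (m n : ℕ) (i : Fin m) (f : SF m n) : SF m n :=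
  fun x s => fderiv ℝ (fun t => f t s) x (Pi.single i 1)

/-- The super Laplace operator `Δ = 4 Σ_j ∂_{x`_{2j-1}} ∂_{x`_{2j}} - Σ_j ∂_{x_j}²`. -/
def superLap (m n : ℕ) (f : SF m n) : SF m n :=
  fun x => lapF n (f x) - ∑ i : Fin m, bderiv m n i (bderiv m n i f) x

/-- The element `x² = Σ_{j=1}^n x`_{2j-1} x`_{2j} - Σ_{j=1}^m x_j²` at the point `x`. -/
def xsqElem (m n : ℕ) (x : (Fin m) → ℝ) : Gr ℂ (2 * n) :=
  xsq n + (-(∑ i : Fin m, ((x i : ℂ)) ^ 2)) • Gr.one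

/-- The super Gaussian `exp(x²/2) = exp(-(x_1²+⋯+x_m²)/2) Σ_{j=0}^n (x`²)^j/(2^j j!)`. -/
def gaussFun (m n : ℕ) : SF m n :=
  fun x => ((Real.exp (-(∑ i : Fin m, (x i) ^ 2) / 2) : ℝ) : ℂ) • fermGauss n

/-- The Euler operator `𝔼 = Σ_j x_j ∂_{x_j} + Σ_j x`_j ∂_{x`_j}`. -/
def euler (m n : ℕ) (f : SF m n) : SF m n :=
  fun x => (∑ i : Fin m, ((x i : ℂ)) • bderiv m n i f x) +
    ∑ t : Fin (2 * n), Gr.mul (Gr.gen t) (Gr.pderiv t (f x))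

/-- The super integral `∫_{ℝ^{m|2n}} f = ∫_{ℝ^m} dV(x) ∫_B f`. -/
def superInt (m n : ℕ) (f : SF m n) : ℂ := ∫ x : (Fin m) → ℝ, berezin n (f x)

end
noncomputable section

/-- Elements of `ℂ[x_1,…,x_m] ⊗ Λ_{2n}`: Grassmann elements whose coefficients are
polynomials in the commuting variables. -/
abbrev PG (m n : ℕ) : Type := Gr (MvPolynomial (Fin m) ℂ) (2 * n)

/-- `H` is homogeneous of total degree `l`, counting both commuting and
anticommuting variables. -/
def PHomog (m n : ℕ) (H : PG m n) (l : ℕ) : Prop :=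
  ∀ s : Finset (Fin (2 * n)), ∀ d ∈ (H s).support, (d.sum fun _ e => e) + s.card = l

/-- The super Laplace operator `Δ = 4 Σ_j ∂_{x`_{2j-1}} ∂_{x`_{2j}} - Σ_j ∂_{x_j}²`
on `ℂ[x_1,…,x_m] ⊗ Λ_{2n}`. -/
def superLapP (m n : ℕ) (H : PG m n) : PG m n :=
  fun s => (4 : MvPolynomial (Fin m) ℂ) *
      (∑ j : Fin n, Gr.pderiv (lo n j) (Gr.pderiv (hi n j) H) s)
    - ∑ i : Fin m, MvPolynomial.pderiv i (MvPolynomial.pderiv i (H s))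

/-- Evaluation of an element of `ℂ[x_1,…,x_m] ⊗ Λ_{2n}` at the point `x ∈ ℝ^m`,
giving a `Λ_{2n}`-valued function. -/
def evalP (m n : ℕ) (H : PG m n) : SF m n :=
  fun x s => MvPolynomial.eval (fun i => ((x i : ℝ) : ℂ)) (H s)

end
noncomputable section

/-- The odd operator substituted for the generator indexed `t`: the paper's substitution
`x`_{2i} → 2 ∂_{x`_{2i-1}}` and `x`_{2i-1} → -2 ∂_{x`_{2i}}`. -/
def Dop (n : ℕ) (t : Fin (2 * n)) (g : Gr ℂ (2 * n)) : Gr ℂ (2 * n) :=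
  if h : (t : ℕ) % 2 = 0 then
    (-2 : ℂ) • Gr.pderiv ⟨(t : ℕ) + 1, by have := t.isLt; omega⟩ g
  else
    (2 : ℂ) • Gr.pderiv ⟨(t : ℕ) - 1, by have := t.isLt; omega⟩ g

/-- The operator substituted for the commuting variable `x_i`, namely `-∂_{x_i}`. -/
def bosD (m n : ℕ) (i : Fin m) (f : SF m n) : SF m n :=
  fun x s => -(fderiv ℝ (fun t => f t s) x (Pi.single i 1))

/-- Composition of a list of operators (the head acting outermost). -/
def opProd {m n : ℕ} (l : List (SF m n → SF m n)) : SF m n → SF m n :=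
  l.foldr (· ∘ ·) id

/-- The operator substituted for the commuting monomial `x^d`. -/
def bosMono (m n : ℕ) (d : (Fin m) →₀ ℕ) : SF m n → SF m n :=
  opProd ((List.finRange m).map fun i => (bosD m n i)^[d i])

/-- The operator substituted for the Grassmann monomial indexed by `A` (written in
increasing order of the generators). -/
def grassOp (m n : ℕ) (A : Finset (Fin (2 * n))) : SF m n → SF m n :=
  opProd ((A.sort (· ≤ ·)).map fun t => fun (F : SF m n) x => Dop n t (F x))

/-- The constant-coefficient differential operator `p(∂_x)` obtained from
`p ∈ ℂ[x_1,…,x_m] ⊗ Λ_{2n}` by substituting `x_i → -∂_{x_i}`,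
`x`_{2i} → 2∂_{x`_{2i-1}}` and `x`_{2i-1} → -2∂_{x`_{2i}}`. -/
def pOp (m n : ℕ) (H : PG m n) (F : SF m n) : SF m n :=
  ∑ A : Finset (Fin (2 * n)), ∑ d ∈ (H A).support,
    MvPolynomial.coeff d (H A) • bosMono m n d (grassOp m n A F)

end

namespace Gr

section Algebra

variable {R : Type} [CommRing R] {N : ℕ}

theorem msign_eq_prod (A B : Finset (Fin N)) :
    (msign A B : R) = ∏ a ∈ A, ∏ b ∈ B, if b < a then -1 else 1 := by
  rw [← Finset.prod_product', Finset.prod_ite, Finset.prod_const, Finset.prod_const_one, mul_one,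
    msign]

theorem msign_insert_left {t : Fin N} {A : Finset (Fin N)} (h : t ∉ A) (B : Finset (Fin N)) :
    (msign (insert t A) B : R) = msign {t} B * msign A B := by
  simp [msign_eq_prod, Finset.prod_insert h]

theorem msign_insert_right {t : Fin N} {B : Finset (Fin N)} (h : t ∉ B) (A : Finset (Fin N)) :
    (msign A (insert t B) : R) = msign A {t} * msign A B := by
  simp only [msign_eq_prod, Finset.prod_insert h, Finset.prod_mul_distrib, Finset.prod_singleton]

theorem msign_mul_self (A B : Finset (Fin N)) : (msign A B : R) * msign A B = 1 := by
  rw [msign, ← mul_pow]; simp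

theorem msign_singleton_comm {t : Fin N} {A : Finset (Fin N)} (h : t ∉ A) :
    (msign {t} A : R) = (-1) ^ A.card * msign A {t} := by
  simp only [msign_eq_prod, Finset.prod_singleton]
  rw [← Finset.prod_const, ← Finset.prod_mul_distrib]
  refine Finset.prod_congr rfl fun a ha => ?_
  have hne : a ≠ t := fun e => h (e ▸ ha)
  rcases lt_or_gt_of_ne hne with h' | h' <;> simp [h', h'.not_gt]

@[simp]
theorem msign_empty_right (A : Finset (Fin N)) : (msign A ∅ : R) = 1 := by
  simp [msign]

theorem msign_singleton_left (t : Fin N) (A : Finset (Fin N)) :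
    (msign {t} A : R) = (-1) ^ (A.filter fun i => i < t).card := by
  simp [msign_eq_prod, Finset.prod_ite]

/-- The partial derivative as a linear map. -/
def der (t : Fin N) : Gr R N →ₗ[R] Gr R N where
  toFun := pderiv t
  map_add' f g := by ext s; simp only [pderiv, Pi.add_apply]; split_ifs <;> ring
  map_smul' r f := by
    ext s; simp only [pderiv, Pi.smul_apply, smul_eq_mul, RingHom.id_apply]; split_ifs <;> ring

/-- Left multiplication by a generator. -/
def wedge (t : Fin N) : Gr R N →ₗ[R] Gr R N where
  toFun f := fun s => if t ∈ s then msign {t} (s.erase t) * f (s.erase t) else 0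
  map_add' f g := by ext s; simp only [Pi.add_apply]; split_ifs <;> ring
  map_smul' r f := by
    ext s; simp only [Pi.smul_apply, smul_eq_mul, RingHom.id_apply]; split_ifs <;> ring

/-- The parity automorphism. -/
def inv (f : Gr R N) : Gr R N := fun s => (-1) ^ s.card * f s

/-- The fermionic Euler operator, multiplying by the degree. -/
def deg : Gr R N →ₗ[R] Gr R N where
  toFun f := fun s => (s.card : R) * f s
  map_add' f g := by ext s; simp only [Pi.add_apply]; ring
  map_smul' r f := by ext s; simp only [Pi.smul_apply, smul_eq_mul, RingHom.id_apply]; ring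

theorem der_of_mem {t : Fin N} {s : Finset (Fin N)} (h : t ∈ s) (f : Gr R N) : der t f s = 0 := by
  simp [der, pderiv, h]

theorem der_of_notMem {t : Fin N} {s : Finset (Fin N)} (h : t ∉ s) (f : Gr R N) :
    der t f s = msign {t} s * f (insert t s) := by
  simp [der, pderiv, h, msign_singleton_left]

theorem wedge_of_notMem {t : Fin N} {s : Finset (Fin N)} (h : t ∉ s) (f : Gr R N) :
    wedge t f s = 0 := by
  simp [wedge, h]

theorem wedge_insert {t : Fin N} {s : Finset (Fin N)} (h : t ∉ s) (f : Gr R N) :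
    wedge t f (insert t s) = msign {t} s * f s := by
  simp [wedge, h]

theorem msign_pair {s t : Fin N} (h : s ≠ t) : (msign {s} {t} : R) = - msign {t} {s} := by
  rw [msign_singleton_comm (by simpa using h)]; simp

theorem der_wedge_self (t : Fin N) (f : Gr R N) :
    der t (wedge t f) = f - wedge t (der t f) := by
  ext u
  simp only [Pi.sub_apply]
  by_cases hu : t ∈ u
  · obtain ⟨v, hv, rfl⟩ : ∃ v, t ∉ v ∧ insert t v = u :=
      ⟨u.erase t, by simp, Finset.insert_erase hu⟩
    rw [der_of_mem hu, wedge_insert hv, der_of_notMem hv, ← mul_assoc, msign_mul_self]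
    ring
  · rw [der_of_notMem hu, wedge_of_notMem hu, wedge_insert hu, ← mul_assoc, msign_mul_self]
    ring

theorem der_wedge_of_ne {s t : Fin N} (h : s ≠ t) (f : Gr R N) :
    der s (wedge t f) = - wedge t (der s f) := by
  ext u
  simp only [Pi.neg_apply]
  by_cases hu : t ∈ u
  · obtain ⟨v, hv, rfl⟩ : ∃ v, t ∉ v ∧ insert t v = u :=
      ⟨u.erase t, by simp, Finset.insert_erase hu⟩
    rw [wedge_insert hv]
    by_cases hs : s ∈ v
    · rw [der_of_mem (by simp [hs]), der_of_mem hs]; ring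
    · rw [der_of_notMem (by simp [hs, h]), der_of_notMem hs, Finset.insert_comm,
        wedge_insert (by simp [hv, h.symm]), msign_insert_right hv, msign_insert_right hs,
        msign_pair h]
      linear_combination (-(msign {s} v) * msign {t} v * f (insert s v)) *
        msign_mul_self (R := R) {t} {s}
  · rw [wedge_of_notMem hu]
    by_cases hs : s ∈ u
    · rw [der_of_mem hs]; ring
    · rw [der_of_notMem hs, wedge_of_notMem (by simp [hu, h.symm])]; ring

theorem der_der_comm (s t : Fin N) (f : Gr R N) : der s (der t f) = - der t (der s f) := by
  ext u
  simp only [Pi.neg_apply]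
  by_cases hs : s ∈ u
  · rw [der_of_mem hs]
    by_cases ht : t ∈ u
    · rw [der_of_mem ht]; ring
    · rw [der_of_notMem ht, der_of_mem (by simp [hs])]; ring
  · rw [der_of_notMem hs]
    by_cases ht : t ∈ u
    · rw [der_of_mem ht, der_of_mem (by simp [ht])]; ring
    · rw [der_of_notMem ht]
      by_cases h : s = t
      · subst h
        rw [der_of_mem (by simp)]; ring
      · rw [der_of_notMem (by simp [ht, Ne.symm h]), der_of_notMem (by simp [hs, h]),
          msign_insert_right hs, msign_insert_right ht, msign_pair h, Finset.insert_comm]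
        ring

theorem deg_wedge (t : Fin N) (f : Gr R N) : deg (wedge t f) = wedge t (deg f) + wedge t f := by
  ext u
  by_cases hu : t ∈ u
  · obtain ⟨v, hv, rfl⟩ : ∃ v, t ∉ v ∧ insert t v = u :=
      ⟨u.erase t, by simp, Finset.insert_erase hu⟩
    simp only [Pi.add_apply, wedge_insert hv, deg, LinearMap.coe_mk, AddHom.coe_mk,
      Finset.card_insert_of_notMem hv]
    push_cast; ring
  · simp [deg, wedge_of_notMem hu]

theorem deg_der (t : Fin N) (f : Gr R N) : deg (der t f) = der t (deg f) - der t f := by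
  ext u
  by_cases hu : t ∈ u
  · simp [deg, der_of_mem hu]
  · simp only [Pi.sub_apply, der_of_notMem hu, deg, LinearMap.coe_mk, AddHom.coe_mk,
      Finset.card_insert_of_notMem hu]
    push_cast; ring

theorem mul_insert {t : Fin N} {s : Finset (Fin N)} (h : t ∉ s) (f g : Gr R N) :
    mul f g (insert t s) =
      (∑ A ∈ s.powerset, msign A {t} * msign A (s \ A) * f A * g (insert t (s \ A))) +
      ∑ A ∈ s.powerset, msign {t} (s \ A) * msign A (s \ A) * f (insert t A) * g (s \ A) := by
  rw [mul, Finset.sum_powerset_insert h]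
  congr 1 <;> refine Finset.sum_congr rfl fun A hA => ?_ <;>
    have hA' : t ∉ A := fun h' => h (Finset.mem_powerset.1 hA h')
  · rw [Finset.insert_sdiff_of_notMem _ hA', msign_insert_right (by simp [h])]
  · rw [Finset.insert_sdiff_insert, Finset.sdiff_insert_of_notMem h, msign_insert_left hA']

theorem wedge_mul (t : Fin N) (f g : Gr R N) : wedge t (mul f g) = mul (wedge t f) g := by
  ext u
  by_cases hu : t ∈ u
  · obtain ⟨v, hv, rfl⟩ : ∃ v, t ∉ v ∧ insert t v = u :=
      ⟨u.erase t, by simp, Finset.insert_erase hu⟩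
    rw [wedge_insert hv, mul_insert hv, Finset.sum_eq_zero, zero_add, mul, Finset.mul_sum]
    · refine Finset.sum_congr rfl fun A hA => ?_
      have hA' : t ∉ A := fun h' => hv (Finset.mem_powerset.1 hA h')
      rw [wedge_insert hA']
      have : (msign {t} v : R) = msign {t} (v \ A) * msign {t} A := by
        simp only [msign_eq_prod, Finset.prod_singleton]
        rw [Finset.prod_sdiff (Finset.mem_powerset.1 hA)]
      rw [this]; ring
    · intro A hA
      have hA' : t ∉ A := fun h' => hv (Finset.mem_powerset.1 hA h')
      rw [wedge_of_notMem hA']; ring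
  · rw [wedge_of_notMem hu, mul, Finset.sum_eq_zero]
    intro A hA
    have hA' : t ∉ A := fun h' => hu (Finset.mem_powerset.1 hA h')
    rw [wedge_of_notMem hA']; ring

theorem inv_mul_wedge (t : Fin N) (f g : Gr R N) : mul (inv f) (wedge t g) = mul (wedge t f) g := by
  ext u
  by_cases hu : t ∈ u
  · obtain ⟨v, hv, rfl⟩ : ∃ v, t ∉ v ∧ insert t v = u :=
      ⟨u.erase t, by simp, Finset.insert_erase hu⟩
    rw [mul_insert hv, mul_insert hv, ← Finset.sum_add_distrib, ← Finset.sum_add_distrib]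
    refine Finset.sum_congr rfl fun A hA => ?_
    have hA' : t ∉ A := fun h' => hv (Finset.mem_powerset.1 hA h')
    have hB : t ∉ v \ A := by simp [hv]
    rw [wedge_insert hA', wedge_insert hB, wedge_of_notMem hA', wedge_of_notMem hB,
      msign_singleton_comm hA', inv]
    ring
  · rw [mul, mul]
    refine Finset.sum_congr rfl fun A hA => ?_
    have hA' : t ∉ A := fun h' => hu (Finset.mem_powerset.1 hA h')
    rw [wedge_of_notMem hA', wedge_of_notMem (by simp [hu])]; ring

theorem der_mul (t : Fin N) (f g : Gr R N) :
    der t (mul f g) = mul (der t f) g + mul (inv f) (der t g) := by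
  ext u
  rw [Pi.add_apply]
  by_cases hu : t ∈ u
  · obtain ⟨v, hv, rfl⟩ : ∃ v, t ∉ v ∧ insert t v = u :=
      ⟨u.erase t, by simp, Finset.insert_erase hu⟩
    rw [der_of_mem hu, mul_insert hv, mul_insert hv, ← Finset.sum_add_distrib,
      ← Finset.sum_add_distrib, ← Finset.sum_add_distrib, Finset.sum_eq_zero]
    intro A hA
    have hA' : t ∉ A := fun h' => hv (Finset.mem_powerset.1 hA h')
    have hB : t ∉ v \ A := by simp [hv]
    rw [der_of_mem (Finset.mem_insert_self t A), der_of_mem (Finset.mem_insert_self t _),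
      der_of_notMem hA', der_of_notMem hB, inv, inv, Finset.card_insert_of_notMem hA',
      msign_singleton_comm hA']
    have h1 := msign_mul_self (R := R) A {t}
    have h2 := msign_mul_self (R := R) {t} (v \ A)
    linear_combination (msign A (v \ A) * (-1) ^ A.card * f (insert t A) * g (insert t (v \ A))) *
      (h1 - h2)
  · rw [der_of_notMem hu, mul_insert hu, mul, mul, ← Finset.sum_add_distrib,
      ← Finset.sum_add_distrib, Finset.mul_sum]
    refine Finset.sum_congr rfl fun A hA => ?_
    have hA' : t ∉ A := fun h' => hu (Finset.mem_powerset.1 hA h')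
    have hB : t ∉ u \ A := by simp [hu]
    have : (msign {t} u : R) = msign {t} (u \ A) * msign {t} A := by
      simp only [msign_eq_prod, Finset.prod_singleton]
      rw [Finset.prod_sdiff (Finset.mem_powerset.1 hA)]
    rw [der_of_notMem hA', der_of_notMem hB, inv, this, msign_singleton_comm hA']
    have h1 := msign_mul_self (R := R) A {t}
    have h2 := msign_mul_self (R := R) {t} (u \ A)
    linear_combination (msign A (u \ A) * (-1) ^ A.card * f A * g (insert t (u \ A)) *
      msign {t} (u \ A)) * h1 + (msign A (u \ A) * (-1) ^ A.card * msign A {t} *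
        f (insert t A) * g (u \ A)) * h2

theorem mul_one_right (f : Gr R N) : mul f one = f := by
  ext s
  rw [mul, Finset.sum_eq_single s]
  · simp [one]
  · intro A hA hne
    have : s \ A ≠ ∅ := fun h =>
      hne (Finset.Subset.antisymm (Finset.mem_powerset.1 hA) (Finset.sdiff_eq_empty_iff_subset.1 h))
    simp [one, this]
  · simp

theorem one_mul_left (f : Gr R N) : mul one f = f := by
  ext s
  rw [mul, Finset.sum_eq_single ∅]
  · simp [one, msign]
  · intro A _ hne
    simp [one, hne]
  · simp

/-- Multiplication as a bilinear map. -/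
def mulₗ : Gr R N →ₗ[R] Gr R N →ₗ[R] Gr R N :=
  LinearMap.mk₂ R mul
    (fun f f' g => by
      ext s; simp only [mul, Pi.add_apply, ← Finset.sum_add_distrib]
      exact Finset.sum_congr rfl fun _ _ => by ring)
    (fun r f g => by
      ext s; simp only [mul, Pi.smul_apply, smul_eq_mul, Finset.mul_sum]
      exact Finset.sum_congr rfl fun _ _ => by ring)
    (fun f g g' => by
      ext s; simp only [mul, Pi.add_apply, ← Finset.sum_add_distrib]
      exact Finset.sum_congr rfl fun _ _ => by ring)
    (fun r f g => by
      ext s; simp only [mul, Pi.smul_apply, smul_eq_mul, Finset.mul_sum]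
      exact Finset.sum_congr rfl fun _ _ => by ring)

theorem mulₗ_apply (f g : Gr R N) : mulₗ f g = mul f g := rfl

theorem gen_mul (t : Fin N) (f : Gr R N) : mul (gen t) f = wedge t f := by
  have : gen t = wedge (R := R) t one := by
    ext s
    by_cases h : t ∈ s
    · obtain ⟨v, hv, rfl⟩ : ∃ v, t ∉ v ∧ insert t v = s :=
        ⟨s.erase t, by simp, Finset.insert_erase h⟩
      rw [wedge_insert hv]
      by_cases hv0 : v = ∅
      · subst hv0; simp [gen, one]
      · have : insert t v ≠ {t} := by
          intro e
          apply hv0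
          rw [← Finset.erase_insert hv, e]; simp
        simp [gen, one, hv0, this]
    · rw [wedge_of_notMem h]
      have : s ≠ {t} := by rintro rfl; simp at h
      simp [gen, this]
  rw [this, ← wedge_mul, one_mul_left]

theorem der_one (t : Fin N) : der (R := R) t one = 0 := by
  ext s
  by_cases h : t ∈ s
  · rw [der_of_mem h]; rfl
  · rw [der_of_notMem h]; simp [one]

/-- Elements supported in degree `j`. -/
def IsHomog (f : Gr R N) (j : ℕ) : Prop := ∀ s : Finset (Fin N), f s ≠ 0 → s.card = j

theorem IsHomog.mul {f g : Gr R N} {i j : ℕ} (hf : IsHomog f i) (hg : IsHomog g j) :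
    IsHomog (mul f g) (i + j) := by
  intro s hs
  obtain ⟨A, hA, h⟩ := Finset.exists_ne_zero_of_sum_ne_zero hs
  have h1 := hf A fun e => h (by simp [e])
  have h2 := hg (s \ A) fun e => h (by simp [e])
  rw [← h1, ← h2, add_comm, Finset.card_sdiff_add_card_eq_card (Finset.mem_powerset.1 hA)]

theorem isHomog_gen (t : Fin N) : IsHomog (gen (R := R) t) 1 := by
  intro s hs
  by_cases h : s = {t}
  · simp [h]
  · simp [gen, h] at hs

theorem isHomog_one : IsHomog (one : Gr R N) 0 := by
  intro s hs
  by_cases h : s = ∅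
  · simp [h]
  · simp [one, h] at hs

theorem IsHomog.pow {f : Gr R N} {i : ℕ} (hf : IsHomog f i) (j : ℕ) :
    IsHomog (pow f j) (j * i) := by
  induction j with
  | zero => simpa [Gr.pow] using isHomog_one
  | succ j ih => rw [Nat.succ_mul]; exact ih.mul hf

theorem IsHomog.inv_eq {f : Gr R N} {i : ℕ} (hf : IsHomog f i) (hi : Even i) : inv f = f := by
  ext s
  by_cases h : f s = 0
  · simp [inv, h]
  · simp [inv, hf s h, hi.neg_one_pow]

theorem mul_right_injective_of_apply_empty {g : Gr R N} (hg : g ∅ = 1) {f f' : Gr R N}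
    (h : mul f g = mul f' g) : f = f' := by
  rw [← sub_eq_zero] at h ⊢
  have h' : mul (f - f') g = 0 := by
    rw [← h, ← mulₗ_apply, ← mulₗ_apply, ← mulₗ_apply, map_sub, LinearMap.sub_apply]
  ext s
  induction s using Finset.strongInduction with
  | H s ih =>
    have := congrFun h' s
    rw [mul, Finset.sum_eq_single s] at this
    · simpa [hg] using this
    · intro A hA hne
      rw [ih A ((Finset.mem_powerset.1 hA).ssubset_of_ne hne)]; simp
    · simp

end Algebra

end Gr

section Fermionic

open Gr

theorem eq_lo_or_eq_hi (n : ℕ) (t : Fin (2 * n)) : ∃ j, t = lo n j ∨ t = hi n j := by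
  have := t.isLt
  refine ⟨⟨t / 2, by omega⟩, ?_⟩
  simp only [lo, hi, Fin.ext_iff]
  omega

theorem lo_ne_hi (n : ℕ) (i j : Fin n) : lo n i ≠ hi n j := by
  simp only [lo, hi, ne_eq, Fin.ext_iff]; omega

theorem lo_injective (n : ℕ) : Function.Injective (lo n) := fun i j h => by
  simp only [lo, Fin.ext_iff] at h ⊢; omega

theorem hi_injective (n : ℕ) : Function.Injective (hi n) := fun i j h => by
  simp only [hi, Fin.ext_iff] at h ⊢; omega

theorem Dop_lo (n : ℕ) (j : Fin n) (f : Gr ℂ (2 * n)) :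
    Dop n (lo n j) f = (-2 : ℂ) • der (hi n j) f := by
  simp [Dop, lo, hi, der]

theorem Dop_hi (n : ℕ) (j : Fin n) (f : Gr ℂ (2 * n)) :
    Dop n (hi n j) f = (2 : ℂ) • der (lo n j) f := by
  simp [Dop, lo, hi, der, Nat.add_mod]

theorem exists_Dop_eq (n : ℕ) (t : Fin (2 * n)) :
    ∃ (c : ℂ) (u : Fin (2 * n)), ∀ f, Dop n t f = c • der u f := by
  obtain ⟨j, rfl | rfl⟩ := eq_lo_or_eq_hi n t
  · exact ⟨_, _, Dop_lo n j⟩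
  · exact ⟨_, _, Dop_hi n j⟩

theorem Dop_smul (n : ℕ) (t : Fin (2 * n)) (r : ℂ) (f : Gr ℂ (2 * n)) :
    Dop n t (r • f) = r • Dop n t f := by
  obtain ⟨c, u, h⟩ := exists_Dop_eq n t
  rw [h, h, map_smul, smul_comm]

theorem xsq_eq (n : ℕ) : xsq n = ∑ j, wedge (lo n j) (wedge (hi n j) one) := by
  refine Finset.sum_congr rfl fun j _ => ?_
  rw [gen_mul, ← gen_mul (hi n j), mul_one_right]

theorem isHomog_xsq (n : ℕ) : IsHomog (xsq n) 2 := by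
  intro s hs
  rw [xsq, Finset.sum_apply] at hs
  obtain ⟨j, -, h⟩ := Finset.exists_ne_zero_of_sum_ne_zero hs
  exact (isHomog_gen _).mul (isHomog_gen _) s h

theorem der_lo_xsq (n : ℕ) (i : Fin n) :
    der (lo n i) (xsq n) = (1 : ℂ) • wedge (hi n i) one := by
  rw [xsq_eq, map_sum, Finset.sum_eq_single i, der_wedge_self,
    der_wedge_of_ne (lo_ne_hi n i i), der_one]
  · simp
  · intro j _ hj
    rw [der_wedge_of_ne fun h => hj (lo_injective n h).symm, der_wedge_of_ne (lo_ne_hi n i j),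
      der_one]
    simp
  · simp

theorem der_hi_xsq (n : ℕ) (i : Fin n) :
    der (hi n i) (xsq n) = (-1 : ℂ) • wedge (lo n i) one := by
  rw [xsq_eq, map_sum, Finset.sum_eq_single i, der_wedge_of_ne (lo_ne_hi n i i).symm,
    der_wedge_self, der_one]
  · simp
  · intro j _ hj
    rw [der_wedge_of_ne (lo_ne_hi n j i).symm, der_wedge_of_ne fun h => hj (hi_injective n h).symm,
      der_one]
    simp
  · simp

theorem Gr.der_pow {N : ℕ} {x : Gr ℂ N} (hx : IsHomog x 2) {t u : Fin N} {c : ℂ}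
    (h : der t x = c • wedge u one) (j : ℕ) :
    der t (pow x (j + 1)) = ((j + 1 : ℕ) * c) • wedge u (pow x j) := by
  induction j with
  | zero => simp [pow, one_mul_left, h]
  | succ j ih =>
    rw [pow, der_mul, ih, h, ((hx.pow (j + 1)).inv_eq (by simp)), ← mulₗ_apply, ← mulₗ_apply,
      map_smul, map_smul, LinearMap.smul_apply, mulₗ_apply, mulₗ_apply,
      ← wedge_mul, ← (hx.pow (j + 1)).inv_eq (by simp), inv_mul_wedge, mul_one_right,
      (hx.pow (j + 1)).inv_eq (by simp),
      show pow x (j + 1) = mul (pow x j) x from rfl, ← add_smul]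
    congr 1
    push_cast; ring

theorem wedge_pow_xsq (n : ℕ) (u : Fin (2 * n)) : wedge u (pow (xsq n) n) = 0 := by
  ext s
  by_cases hu : u ∈ s
  · obtain ⟨v, hv, rfl⟩ : ∃ v, u ∉ v ∧ insert u v = s :=
      ⟨s.erase u, by simp, Finset.insert_erase hu⟩
    rw [wedge_insert hv]
    have : pow (xsq n) n v = 0 := by
      by_contra h
      have h1 := (isHomog_xsq n).pow n v h
      have h2 := Finset.card_le_univ (insert u v)
      rw [Finset.card_insert_of_notMem hv, Fintype.card_fin] at h2
      omega
    simp [this]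
  · rw [wedge_of_notMem hu]; rfl

theorem der_fermGauss {n : ℕ} {t u : Fin (2 * n)} {c : ℂ}
    (h : der t (xsq n) = c • wedge u one) :
    der t (fermGauss n) = (c / 2) • wedge u (fermGauss n) := by
  rw [fermGauss, map_sum, map_sum, Finset.sum_range_succ', Finset.sum_range_succ]
  simp only [map_smul, wedge_pow_xsq, der_pow (isHomog_xsq n) h]
  rw [show pow (xsq n) 0 = one from rfl, der_one]
  simp only [smul_zero, add_zero, Finset.smul_sum, smul_smul]
  refine Finset.sum_congr rfl fun j _ => ?_
  congr 1
  have h1 : (j.factorial : ℂ) ≠ 0 := by exact_mod_cast j.factorial_ne_zero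
  have h2 : ((j : ℂ) + 1) ≠ 0 := by exact_mod_cast j.succ_ne_zero
  rw [Nat.factorial_succ]
  push_cast
  field_simp
  ring

theorem Dop_fermGauss (n : ℕ) (t : Fin (2 * n)) :
    Dop n t (fermGauss n) = wedge t (fermGauss n) := by
  obtain ⟨j, rfl | rfl⟩ := eq_lo_or_eq_hi n t
  · rw [Dop_lo, der_fermGauss (der_hi_xsq n j), smul_smul]; norm_num
  · rw [Dop_hi, der_fermGauss (der_lo_xsq n j), smul_smul]; norm_num

theorem fermGauss_empty (n : ℕ) : fermGauss n ∅ = 1 := by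
  rw [fermGauss, Finset.sum_range_succ', Pi.add_apply, Finset.sum_apply, Finset.sum_eq_zero]
  · simp [pow, one]
  · intro j _
    by_contra h
    have := (isHomog_xsq n).pow (j + 1) ∅ fun e => h (by simp [e])
    simp at this

theorem Dop_mul_fermGauss (n : ℕ) (t : Fin (2 * n)) (f : Gr ℂ (2 * n)) :
    Dop n t (mul f (fermGauss n)) = mul (wedge t f + Dop n t f) (fermGauss n) := by
  obtain ⟨c, u, h⟩ := exists_Dop_eq n t
  have hG := Dop_fermGauss n t
  rw [h] at hG
  rw [h, h, der_mul, smul_add, ← mulₗ_apply _ (der u (fermGauss n)), ← map_smul, hG, mulₗ_apply,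
    inv_mul_wedge, ← mulₗ_apply, ← mulₗ_apply, ← mulₗ_apply, map_add, LinearMap.add_apply, map_smul,
    LinearMap.smul_apply, add_comm]

/-- The fermionic Laplace operator as a linear map. -/
def lapFₗ (n : ℕ) : Gr ℂ (2 * n) →ₗ[ℂ] Gr ℂ (2 * n) :=
  (4 : ℂ) • ∑ j : Fin n, der (lo n j) ∘ₗ der (hi n j)

theorem lapFₗ_apply (n : ℕ) (f : Gr ℂ (2 * n)) :
    lapFₗ n f = (4 : ℂ) • ∑ j : Fin n, der (lo n j) (der (hi n j) f) := by
  simp [lapFₗ, LinearMap.sum_apply]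

theorem lapFₗ_der (n : ℕ) (u : Fin (2 * n)) (f : Gr ℂ (2 * n)) :
    lapFₗ n (der u f) = der u (lapFₗ n f) := by
  rw [lapFₗ_apply, lapFₗ_apply, map_smul, map_sum]
  congr 1
  refine Finset.sum_congr rfl fun j _ => ?_
  rw [der_der_comm (hi n j), map_neg, der_der_comm (lo n j), neg_neg]

theorem lapFₗ_wedge (n : ℕ) (t : Fin (2 * n)) (f : Gr ℂ (2 * n)) :
    lapFₗ n (wedge t f) = wedge t (lapFₗ n f) + (2 : ℂ) • Dop n t f := by
  rw [lapFₗ_apply, lapFₗ_apply, map_smul, map_sum]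
  obtain ⟨i, rfl | rfl⟩ := eq_lo_or_eq_hi n t
  · have : ∀ j, der (lo n j) (der (hi n j) (wedge (lo n i) f)) =
        wedge (lo n i) (der (lo n j) (der (hi n j) f)) - if j = i then der (hi n i) f else 0 := by
      intro j
      rw [der_wedge_of_ne (lo_ne_hi n i j).symm, map_neg]
      by_cases h : j = i
      · subst h; rw [der_wedge_self]; simp
      · rw [der_wedge_of_ne fun h' => h (lo_injective n h')]; simp [h]
    simp only [this, Finset.sum_sub_distrib, Finset.sum_ite_eq', Finset.mem_univ, if_true, Dop_lo]
    module
  · have : ∀ j, der (lo n j) (der (hi n j) (wedge (hi n i) f)) =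
        wedge (hi n i) (der (lo n j) (der (hi n j) f)) + if j = i then der (lo n i) f else 0 := by
      intro j
      by_cases h : j = i
      · subst h
        rw [der_wedge_self, map_sub, der_wedge_of_ne (lo_ne_hi n j j)]
        simp only [if_true]; abel
      · rw [der_wedge_of_ne fun h' => h (hi_injective n h'), map_neg,
          der_wedge_of_ne (lo_ne_hi n j i)]
        simp [h]
    simp only [this, Finset.sum_add_distrib, Finset.sum_ite_eq', Finset.mem_univ, if_true, Dop_hi]
    module

/-- The operator `x_t + D_t` raises eigenvalues of `E + Δ` by one. -/
theorem deg_add_lapFₗ_raise (n : ℕ) (t : Fin (2 * n)) {f : Gr ℂ (2 * n)} {c : ℂ}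
    (h : deg f + lapFₗ n f = c • f) :
    deg (wedge t f + Dop n t f) + lapFₗ n (wedge t f + Dop n t f) =
      (c + 1) • (wedge t f + Dop n t f) := by
  have h1 := congrArg (wedge t) h
  have h2 := congrArg (Dop n t) h
  obtain ⟨r, u, hD⟩ := exists_Dop_eq n t
  rw [map_add, map_add, lapFₗ_wedge, deg_wedge]
  simp only [hD, map_smul, map_add, lapFₗ_der, deg_der] at h1 h2 ⊢
  rw [add_smul, one_smul, smul_add c, smul_comm c r, ← h1, ← h2]
  module

theorem exists_opProd_Dop (m n : ℕ) (b : (Fin m → ℝ) → ℂ) (l : List (Fin (2 * n))) :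
    ∃ f : Gr ℂ (2 * n), deg f + lapFₗ n f = (l.length : ℂ) • f ∧
      opProd (l.map fun t => fun (F : SF m n) x => Dop n t (F x)) (fun x => b x • fermGauss n) =
        fun x => b x • mul f (fermGauss n) := by
  induction l with
  | nil =>
    refine ⟨one, ?_, ?_⟩
    · rw [lapFₗ_apply]
      simp only [der_one, map_zero]
      ext s
      by_cases h : s = ∅ <;> simp [deg, one, h]
    · simp [opProd, one_mul_left]
  | cons t l ih =>
    obtain ⟨f, hf, h⟩ := ih
    refine ⟨wedge t f + Dop n t f, ?_, ?_⟩
    · rw [deg_add_lapFₗ_raise n t hf]; simp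
    · simp only [opProd, List.map_cons, List.foldr_cons, Function.comp_apply] at h ⊢
      rw [h]
      ext1 x
      rw [Dop_smul, Dop_mul_fermGauss]

end Fermionic

section Bosonic

open MvPolynomial

variable {m : ℕ}

/-- The Hermite operator `∑ X_i ∂_i - ∑ ∂_i²` on polynomials. -/
noncomputable def hermiteOp (m : ℕ) : MvPolynomial (Fin m) ℂ →ₗ[ℂ] MvPolynomial (Fin m) ℂ :=
  (∑ i, LinearMap.mulLeft ℂ (X i) ∘ₗ (pderiv i).toLinearMap) -
    ∑ i, (pderiv i).toLinearMap ∘ₗ (pderiv i).toLinearMap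

theorem hermiteOp_apply (P : MvPolynomial (Fin m) ℂ) :
    hermiteOp m P = ∑ i, X i * pderiv i P - ∑ i, pderiv i (pderiv i P) := by
  simp [hermiteOp, LinearMap.sum_apply]

theorem MvPolynomial.pderiv_comm (i j : Fin m) (P : MvPolynomial (Fin m) ℂ) :
    pderiv i (pderiv j P) = pderiv j (pderiv i P) := by
  have h : ⁅(pderiv i : Derivation ℂ (MvPolynomial (Fin m) ℂ) (MvPolynomial (Fin m) ℂ)),
      (pderiv j : Derivation ℂ (MvPolynomial (Fin m) ℂ) (MvPolynomial (Fin m) ℂ))⁆ = 0 := by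
    ext k
    rw [Derivation.commutator_apply, pderiv_X, pderiv_X]
    simp [Pi.single_apply, apply_ite]
  have := DFunLike.congr_fun h P
  rwa [Derivation.commutator_apply, Derivation.zero_apply, sub_eq_zero] at this

/-- The operator `X_i - ∂_i` raises eigenvalues of the Hermite operator by one. -/
theorem hermiteOp_raise (i : Fin m) {P : MvPolynomial (Fin m) ℂ} {c : ℂ}
    (h : hermiteOp m P = c • P) :
    hermiteOp m (X i * P - pderiv i P) = (c + 1) • (X i * P - pderiv i P) := by
  have e1 : hermiteOp m (X i * P) = X i * hermiteOp m P + X i * P - 2 * pderiv i P := by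
    simp only [hermiteOp_apply]
    have a1 : ∀ j, X j * pderiv j (X i * P) =
        X i * (X j * pderiv j P) + if j = i then X i * P else 0 := by
      intro j
      rw [pderiv_mul, pderiv_X]
      by_cases hj : j = i
      · subst hj; simp; ring
      · simp [hj, Ne.symm hj]; ring
    have a2 : ∀ j, pderiv j (pderiv j (X i * P)) =
        X i * pderiv j (pderiv j P) + if j = i then 2 * pderiv i P else 0 := by
      intro j
      rw [pderiv_mul, pderiv_X]
      by_cases hj : j = i
      · subst hj; simp; ring
      · simp [hj, Ne.symm hj]
    simp only [a1, a2, Finset.sum_add_distrib, Finset.sum_ite_eq', Finset.mem_univ, if_true,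
      ← Finset.mul_sum]
    ring
  have e2 : hermiteOp m (pderiv i P) = pderiv i (hermiteOp m P) - pderiv i P := by
    simp only [hermiteOp_apply, map_sub, map_sum]
    have a1 : ∀ j, pderiv i (X j * pderiv j P) =
        X j * pderiv j (pderiv i P) + if j = i then pderiv i P else 0 := by
      intro j
      rw [pderiv_mul, pderiv_X, MvPolynomial.pderiv_comm i j P]
      by_cases hj : j = i
      · subst hj; simp; ring
      · simp [hj]
    have a2 : ∀ j, pderiv i (pderiv j (pderiv j P)) = pderiv j (pderiv j (pderiv i P)) := by
      intro j
      rw [MvPolynomial.pderiv_comm i j, MvPolynomial.pderiv_comm i j]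
    simp only [a1, a2, Finset.sum_add_distrib, Finset.sum_ite_eq', Finset.mem_univ, if_true]
    ring
  rw [map_sub, e1, e2, h, Derivation.map_smul]
  simp only [smul_eq_C_mul, C_add, C_1]
  ring

theorem hasFDerivAt_eval_ofReal (P : MvPolynomial (Fin m) ℂ) (x : Fin m → ℝ) :
    HasFDerivAt (fun t : Fin m → ℝ => eval (fun i => (t i : ℂ)) P)
      (∑ i, eval (fun i => (x i : ℂ)) (pderiv i P) •
        (Complex.ofRealCLM ∘L ContinuousLinearMap.proj (R := ℝ) (φ := fun _ : Fin m => ℝ) i)) x := by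
  induction P using MvPolynomial.induction_on with
  | C a =>
    simp only [eval_C]
    refine (hasFDerivAt_const a x).congr_fderiv (ContinuousLinearMap.ext fun v => ?_)
    simp
  | add P Q hP hQ =>
    simp only [map_add]
    refine (hP.add hQ).congr_fderiv (ContinuousLinearMap.ext fun v => ?_)
    simp [add_mul, Finset.sum_add_distrib]
  | mul_X P j hP =>
    have hX : HasFDerivAt (fun t : Fin m → ℝ => (t j : ℂ))
        (Complex.ofRealCLM ∘L ContinuousLinearMap.proj (R := ℝ) (φ := fun _ : Fin m => ℝ) j) x :=
      (Complex.ofRealCLM ∘L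
        ContinuousLinearMap.proj (R := ℝ) (φ := fun _ : Fin m => ℝ) j).hasFDerivAt
    have := hP.mul hX
    simp only [map_mul, eval_X]
    refine this.congr_fderiv (ContinuousLinearMap.ext fun v => ?_)
    simp [pderiv_X, Pi.single_apply, add_mul, Finset.sum_add_distrib, Finset.mul_sum, apply_ite,
      mul_assoc]

theorem fderiv_eval_ofReal_mul_gauss (P : MvPolynomial (Fin m) ℂ) (c : ℂ) (x : Fin m → ℝ)
    (i : Fin m) :
    fderiv ℝ (fun t : Fin m → ℝ => eval (fun i => (t i : ℂ)) P *
      ((Real.exp (-(∑ i : Fin m, (t i) ^ 2) / 2) : ℝ) : ℂ) * c) x (Pi.single i 1) =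
    -(eval (fun i => (x i : ℂ)) (X i * P - pderiv i P) *
      ((Real.exp (-(∑ i : Fin m, (x i) ^ 2) / 2) : ℝ) : ℂ) * c) := by
  set Q : MvPolynomial (Fin m) ℂ := C (-1 / 2) * ∑ i, X i ^ 2 with hQ
  have hb : ∀ t : Fin m → ℝ, ((Real.exp (-(∑ i : Fin m, (t i) ^ 2) / 2) : ℝ) : ℂ) =
      Complex.exp (eval (fun i => (t i : ℂ)) Q) := by
    intro t
    rw [Complex.ofReal_exp]
    congr 1
    simp only [hQ, map_mul, map_sum, map_pow, eval_X, eval_C]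
    push_cast; ring
  have hQ' : pderiv i Q = - X i := by
    rw [hQ, pderiv_mul, pderiv_C, map_sum, zero_mul, zero_add, Finset.sum_eq_single i]
    · rw [pderiv_pow, pderiv_X_self]
      have : (C (-1 / 2) * 2 : MvPolynomial (Fin m) ℂ) = -1 := by
        rw [show (2 : MvPolynomial (Fin m) ℂ) = C 2 from (map_ofNat C 2).symm, ← C_mul]
        norm_num
      push_cast
      linear_combination (X i) * this
    · intro j _ hj; rw [pderiv_pow, pderiv_X_of_ne hj]; simp
    · simp
  simp only [hb]
  have key := ((hasFDerivAt_eval_ofReal P x).mul (hasFDerivAt_eval_ofReal Q x).cexp).mul_const c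
  have hs : ∀ R : MvPolynomial (Fin m) ℂ,
      (∑ j, eval (fun i => (x i : ℂ)) (pderiv j R) • (Complex.ofRealCLM ∘L
        ContinuousLinearMap.proj (R := ℝ) (φ := fun _ : Fin m => ℝ) j)) (Pi.single i 1) =
      eval (fun i => (x i : ℂ)) (pderiv i R) := by
    intro R
    rw [_root_.sum_apply, Finset.sum_eq_single i]
    · simp
    · intro j _ hj; simp [hj]
    · simp
  have := key.fderiv
  simp only [Pi.mul_apply] at this
  erw [this]
  simp only [_root_.add_apply, _root_.smul_apply, hs, hQ', smul_eq_mul,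
    map_sub, map_mul, eval_X, map_neg]
  simp
  ring

/-- The function `P(x) exp(-|x|²/2) w` for a polynomial `P` and a Grassmann element `w`. -/
noncomputable def polyGauss (m n : ℕ) (P : MvPolynomial (Fin m) ℂ) (w : Gr ℂ (2 * n)) : SF m n :=
  fun x s => eval (fun i => (x i : ℂ)) P *
    ((Real.exp (-(∑ i : Fin m, (x i) ^ 2) / 2) : ℝ) : ℂ) * w s

theorem bosD_polyGauss (n : ℕ) (i : Fin m) (P : MvPolynomial (Fin m) ℂ) (w : Gr ℂ (2 * n)) :
    bosD m n i (polyGauss m n P w) = polyGauss m n (X i * P - pderiv i P) w := by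
  ext x s
  simp only [bosD, polyGauss]
  rw [fderiv_eval_ofReal_mul_gauss, neg_neg]

theorem exists_iterate_bosD (n : ℕ) (i : Fin m) (k : ℕ) {P : MvPolynomial (Fin m) ℂ} {c : ℂ}
    (hP : hermiteOp m P = c • P) :
    ∃ H : MvPolynomial (Fin m) ℂ, hermiteOp m H = (c + k) • H ∧
      ∀ w, (bosD m n i)^[k] (polyGauss m n P w) = polyGauss m n H w := by
  induction k with
  | zero => exact ⟨P, by simpa using hP, fun w => rfl⟩
  | succ k ih =>
    obtain ⟨H, hH, h⟩ := ih
    refine ⟨X i * H - pderiv i H, ?_, fun w => ?_⟩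
    · rw [hermiteOp_raise i hH]; push_cast; ring_nf
    · rw [Function.iterate_succ_apply', h, bosD_polyGauss]

theorem exists_opProd_bosD (n : ℕ) (d : Fin m →₀ ℕ) (l : List (Fin m)) :
    ∃ H : MvPolynomial (Fin m) ℂ, hermiteOp m H = (((l.map d).sum : ℕ) : ℂ) • H ∧
      ∀ w, opProd (l.map fun i => (bosD m n i)^[d i]) (polyGauss m n 1 w) =
        polyGauss m n H w := by
  induction l with
  | nil => exact ⟨1, by simp [hermiteOp_apply], fun w => rfl⟩
  | cons i l ih =>
    obtain ⟨H, hH, h⟩ := ih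
    obtain ⟨H', hH', h'⟩ := exists_iterate_bosD n i (d i) hH
    refine ⟨H', ?_, fun w => ?_⟩
    · rw [hH']; simp [add_comm]
    · simp only [opProd, List.map_cons, List.foldr_cons, Function.comp_apply] at h ⊢
      rw [h, h']

end Bosonic

theorem exists_bosMono (m n : ℕ) (d : Fin m →₀ ℕ) :
    ∃ H : MvPolynomial (Fin m) ℂ, hermiteOp m H = ((d.sum fun _ e => e : ℕ) : ℂ) • H ∧
      ∀ w, bosMono m n d (polyGauss m n 1 w) = polyGauss m n H w := by
  obtain ⟨H, hH, h⟩ := exists_opProd_bosD n d (List.finRange m)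
  refine ⟨H, ?_, h⟩
  rw [hH, ← List.ofFn_eq_map, List.sum_ofFn, Finsupp.sum_fintype _ _ fun _ => rfl]

theorem exists_grassOp (m n : ℕ) (A : Finset (Fin (2 * n))) :
    ∃ f : Gr ℂ (2 * n), Gr.deg f + lapFₗ n f = (A.card : ℂ) • f ∧
      grassOp m n A (gaussFun m n) = polyGauss m n 1 (Gr.mul f (fermGauss n)) := by
  obtain ⟨f, hf, h⟩ := exists_opProd_Dop m n
    (fun x => ((Real.exp (-(∑ i : Fin m, (x i) ^ 2) / 2) : ℝ) : ℂ)) (A.sort (· ≤ ·))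
  refine ⟨f, by rw [hf, Finset.length_sort], h.trans ?_⟩
  ext x s
  simp [polyGauss]

theorem sum_X_mul_pderiv_of_homog {m n k : ℕ} {p : PG m n} (h : PHomog m n p k)
    (s : Finset (Fin (2 * n))) :
    ∑ i, MvPolynomial.X i * MvPolynomial.pderiv i (p s) + (s.card : ℂ) • p s = (k : ℂ) • p s := by
  by_cases h0 : p s = 0
  · simp [h0]
  obtain ⟨d, hd⟩ := Finset.nonempty_iff_ne_empty.2 (MvPolynomial.support_eq_empty.not.2 h0)
  have hk : s.card ≤ k := by have := h s d hd; omega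
  have : (p s).IsHomogeneous (k - s.card) := by
    intro e he
    have h1 := h s e (MvPolynomial.mem_support_iff.2 he)
    rw [← h1, Nat.add_sub_cancel, Finsupp.weight_apply]
    simp
  rw [this.sum_X_mul_pderiv, ← Nat.cast_smul_eq_nsmul ℂ, ← add_smul, ← Nat.cast_add,
    Nat.sub_add_cancel hk]

/-- If `p(∂) exp(x²/2) = p exp(x²/2)`, then `p` is the corresponding combination of products of
Hermite polynomials and Grassmann elements. -/
theorem eq_sum_of_pOp_eq {m n : ℕ} {p : PG m n}
    (hp : pOp m n p (gaussFun m n) = fun x => Gr.mul (evalP m n p x) (gaussFun m n x))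
    {f : Finset (Fin (2 * n)) → Gr ℂ (2 * n)} {H : (Fin m →₀ ℕ) → MvPolynomial (Fin m) ℂ}
    (hf : ∀ A, grassOp m n A (gaussFun m n) = polyGauss m n 1 (Gr.mul (f A) (fermGauss n)))
    (hH : ∀ d w, bosMono m n d (polyGauss m n 1 w) = polyGauss m n (H d) w) :
    p = ∑ A, ∑ d ∈ (p A).support,
      fun s => (MvPolynomial.coeff d (p A) * f A s) • H d := by
  have key : ∀ x : Fin m → ℝ, evalP m n p x = ∑ A, ∑ d ∈ (p A).support,
      (MvPolynomial.coeff d (p A) * MvPolynomial.eval (fun i => (x i : ℂ)) (H d)) • f A := by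
    intro x
    refine Gr.mul_right_injective_of_apply_empty (fermGauss_empty n) ?_
    set b : ℂ := ((Real.exp (-(∑ i : Fin m, (x i) ^ 2) / 2) : ℝ) : ℂ) with hb
    have hb0 : b ≠ 0 := by rw [hb]; exact_mod_cast (Real.exp_pos _).ne'
    have h := congrFun hp x
    have hg : Gr.mul (evalP m n p x) (gaussFun m n x) =
        b • Gr.mul (evalP m n p x) (fermGauss n) := by
      rw [← Gr.mulₗ_apply, ← Gr.mulₗ_apply, ← map_smul]; rfl
    rw [hg] at h
    refine smul_right_injective _ hb0 ?_
    change b • _ = b • _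
    rw [← h, ← Gr.mulₗ_apply, map_sum, LinearMap.sum_apply, pOp, Finset.sum_apply, Finset.smul_sum]
    refine Finset.sum_congr rfl fun A _ => ?_
    rw [map_sum, LinearMap.sum_apply, Finset.sum_apply, Finset.smul_sum]
    refine Finset.sum_congr rfl fun d _ => ?_
    rw [hf, hH, map_smul, LinearMap.smul_apply, Gr.mulₗ_apply]
    ext s
    simp only [Pi.smul_apply, smul_eq_mul, polyGauss, ← hb]
    ring
  ext1 s
  refine MvPolynomial.funext_set (fun _ => Set.range ((↑) : ℝ → ℂ))
    (fun _ => Set.infinite_range_of_injective Complex.ofReal_injective) fun y hy => ?_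
  choose x hx using fun i => hy i (Set.mem_univ i)
  obtain rfl : (fun i => (x i : ℂ)) = y := funext hx
  have h := congrFun (key x) s
  simp only [evalP, Finset.sum_apply, Pi.smul_apply, smul_eq_mul] at h
  simp only [Finset.sum_apply, map_sum, MvPolynomial.smul_eval]
  rw [h]
  exact Finset.sum_congr rfl fun A _ => Finset.sum_congr rfl fun d _ => by ring

theorem Gr.der_smul_const {m N : ℕ} (t : Fin N) (f : Gr ℂ N) (P : MvPolynomial (Fin m) ℂ) :
    Gr.der t (fun s => f s • P) = fun s => Gr.der t f s • P := by
  ext1 s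
  by_cases h : t ∈ s
  · simp [Gr.der_of_mem h]
  · rw [Gr.der_of_notMem h, Gr.der_of_notMem h]
    simp only [Gr.msign, MvPolynomial.smul_eq_C_mul, map_mul, map_pow, map_neg, map_one]
    ring

/-- The operator `E + Δ` on `ℂ[x] ⊗ Λ`. -/
noncomputable def superHermite (m n : ℕ) (p : PG m n) (s : Finset (Fin (2 * n))) :
    MvPolynomial (Fin m) ℂ :=
  hermiteOp m (p s) + (s.card : ℂ) • p s +
    (4 : ℂ) • ∑ j : Fin n, Gr.der (lo n j) (Gr.der (hi n j) p) s

theorem superHermite_sum (m n : ℕ) {ι : Type*} (S : Finset ι) (q : ι → PG m n)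
    (s : Finset (Fin (2 * n))) :
    superHermite m n (∑ i ∈ S, q i) s = ∑ i ∈ S, superHermite m n (q i) s := by
  simp only [superHermite, Finset.sum_apply, map_sum, Finset.smul_sum, Finset.sum_add_distrib]
  congr 1
  rw [Finset.sum_comm]

theorem superHermite_smul_const {m n : ℕ} {f : Gr ℂ (2 * n)} {P : MvPolynomial (Fin m) ℂ}
    {a b : ℂ} (hf : Gr.deg f + lapFₗ n f = a • f) (hP : hermiteOp m P = b • P) (c : ℂ)
    (s : Finset (Fin (2 * n))) :
    superHermite m n (fun s => (c * f s) • P) s = (a + b) • ((c * f s) • P) := by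
  have h := congrFun hf s
  rw [lapFₗ_apply] at h
  simp only [Gr.deg, LinearMap.coe_mk, AddHom.coe_mk, Pi.add_apply, Pi.smul_apply,
    Finset.sum_apply, smul_eq_mul] at h
  have hc : (fun s => (c * f s) • P) = fun s => (c • f) s • P := rfl
  rw [superHermite, hc]
  simp only [Gr.der_smul_const, map_smul, hP, Pi.smul_apply, ← Finset.sum_smul, smul_smul,
    ← add_smul, smul_eq_mul]
  have hs : ∑ j, Gr.der (lo n j) (Gr.der (hi n j) fun s => c * f s) s =
      c * ∑ j, Gr.der (lo n j) (Gr.der (hi n j) f) s := by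
    rw [Finset.mul_sum]
    refine Finset.sum_congr rfl fun j _ => ?_
    rw [show (fun s => c * f s) = c • f from rfl, map_smul, map_smul]
    rfl
  congr 1
  linear_combination c * h + 4 * hs

/-- Suppose the super-dimension `M = m - 2n` does not belong to `{0, -2, -4, …}`.  If
`p ∈ ℂ[x_1,…,x_m] ⊗ Λ_{2n}` is homogeneous of total degree `k` and satisfies
`p(∂_x) exp(x²/2) = p(x) exp(x²/2)`, then `Δ p = 0`, i.e. `p` is a super spherical
harmonic of degree `k`. -/
theorem diff_gauss_implies_harmonic (m n k : ℕ) (hm : 1 ≤ m)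
    (hM : ∀ t : ℕ, (m : ℤ) - 2 * (n : ℤ) ≠ -(2 * (t : ℤ)))
    (p : PG m n) (hhom : PHomog m n p k)
    (hp : pOp m n p (gaussFun m n) = fun x => Gr.mul (evalP m n p x) (gaussFun m n x)) :
    superLapP m n p = 0 := by
  choose f hf hf' using exists_grassOp m n
  choose H hH hH' using exists_bosMono m n
  have hsum := eq_sum_of_pOp_eq hp hf' hH'
  ext1 s
  have h1 : superHermite m n p s = (k : ℂ) • p s := by
    conv_lhs => rw [hsum]
    conv_rhs => rw [hsum]
    rw [superHermite_sum, Finset.sum_apply, Finset.smul_sum]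
    refine Finset.sum_congr rfl fun A _ => ?_
    rw [superHermite_sum, Finset.sum_apply, Finset.smul_sum]
    refine Finset.sum_congr rfl fun d hd => ?_
    rw [superHermite_smul_const (hf A) (hH d), ← hhom A d hd]
    push_cast
    rw [add_comm (A.card : ℂ)]
  rw [← sum_X_mul_pderiv_of_homog hhom s, superHermite, hermiteOp_apply] at h1
  have h4 : superLapP m n p s = (4 : ℂ) • ∑ j : Fin n, Gr.der (lo n j) (Gr.der (hi n j) p) s -
      ∑ i, MvPolynomial.pderiv i (MvPolynomial.pderiv i (p s)) := by
    rw [MvPolynomial.smul_eq_C_mul, map_ofNat]; rfl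
  rw [h4, Pi.zero_apply]
  linear_combination h1
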